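/- arXiv:2210.15263 — 2 statements merged into one kernel-verified Lean document; each statement's English description precedes it below -/
import Mathlib

section
/- Let B be a 5×5 complex matrix (indexed by Fin 5) such that B i j = 0 whenever i ≥ 1, j ≥ 1 and i ≠ j, and B i i = λ for all i ≥ 1, for some λ ∈ ℂ (the first row and first column of B are arbitrary). Suppose B · Bᵀ = μ · I₅ for some μ ≠ 0. Then there exist a nonzero scalar λ and a sign ε ∈ {1, -1} such that B = λ · D, where D is the diagonal matrix with diagonal entries (ε, 1, 1, 1, 1). In particular B is a diagonal matrix. -/
theorem stmt_1 (B : Matrix (Fin 5) (Fin 5) ℂ) (lam mu : ℂ)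
    (hoff : ∀ i j : Fin 5, i ≠ 0 → j ≠ 0 → i ≠ j → B i j = 0)
    (hdiag : ∀ i : Fin 5, i ≠ 0 → B i i = lam)
    (hmu : mu ≠ 0)
    (horth : B * B.transpose = mu • (1 : Matrix (Fin 5) (Fin 5) ℂ)) :
    ∃ (lam' : ℂ) (eps : ℂ), lam' ≠ 0 ∧ (eps = 1 ∨ eps = -1) ∧
      B = lam' • Matrix.diagonal ![eps, 1, 1, 1, 1] := by
  have hdot : ∀ i j, ∑ k, B i k * B j k = if i = j then mu else 0 := fun i j => by
    simpa [Matrix.mul_apply, Matrix.one_apply] using congrFun (congrFun horth i) j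
  have hrow : ∀ i j, i ≠ 0 → B i 0 * B j 0 + lam * B j i = if i = j then mu else 0 := by
    intro i j hi
    rw [← hdot, Fintype.sum_eq_add 0 i hi.symm, hdiag i hi]
    rintro k ⟨hk, hki⟩
    rw [hoff i k hi hk hki.symm, zero_mul]
  have hnorm : ∀ i, i ≠ 0 → B i 0 * B i 0 + lam * lam = mu := fun i hi => by
    simpa [hdiag i hi] using hrow i i hi
  have hcol : ∀ i, i ≠ 0 → B i 0 = 0 := by
    intro i hi
    by_contra hne
    obtain ⟨j, hj, hij⟩ : ∃ j : Fin 5, j ≠ 0 ∧ i ≠ j := by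
      clear hne; decide +revert
    have hprod : B i 0 * B j 0 = 0 := by
      simpa [hij, hoff j i hj hi hij.symm] using hrow i j hi
    have hj0 : B j 0 = 0 := (mul_eq_zero.mp hprod).resolve_left hne
    have hlam : lam * lam = mu := by simpa [hj0] using hnorm j hj
    exact hne (by simpa [hlam] using hnorm i hi)
  have hlam : lam * lam = mu := by simpa [hcol 1 (by decide)] using hnorm 1 (by decide)
  have hlam0 : lam ≠ 0 := by
    rintro rfl
    exact hmu (by simpa using hlam.symm)
  have htop : ∀ i, i ≠ 0 → B 0 i = 0 := fun i hi => by
    simpa [hcol i hi, hi, hlam0] using hrow i 0 hi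
  have hcorner : B 0 0 * B 0 0 = lam * lam := by
    rw [hlam, ← Fintype.sum_eq_single (f := fun k => B 0 k * B 0 k) 0
      (fun k hk => by rw [htop k hk, zero_mul]), hdot, if_pos rfl]
  refine ⟨lam, B 0 0 / lam, hlam0, ?_, ?_⟩
  · rcases mul_self_eq_mul_self_iff.mp hcorner with h | h
    · exact Or.inl (by rw [h, div_self hlam0])
    · exact Or.inr (by rw [h, neg_div, div_self hlam0])
  · ext i j
    rw [Matrix.smul_apply, smul_eq_mul]
    rcases eq_or_ne i j with rfl | hij
    · rw [Matrix.diagonal_apply_eq]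
      rcases eq_or_ne i 0 with rfl | hi
      · simp [mul_div_cancel₀, hlam0]
      · rw [hdiag i hi]
        fin_cases i <;> simp at hi ⊢
    · rw [Matrix.diagonal_apply_ne _ hij, mul_zero]
      rcases eq_or_ne i 0 with rfl | hi
      · exact htop j hij.symm
      · rcases eq_or_ne j 0 with rfl | hj
        · exact hcol i hi
        · exact hoff i j hi hj hij
end

section
/- Let J be the 5×5 complex matrix with J(0,1) = J(1,0) = 1/2, J(i,i) = 1 for i ∈ {2,3,4}, and all other entries zero. Let B be a 5×5 complex matrix such that B i j = 0 whenever i ≥ 1, j ≥ 1 and i ≠ j, and B i i = λ for all i ≥ 1, for some λ ∈ ℂ (the first row and first column of B are arbitrary). Suppose B · J · Bᵀ = μ · J for some μ ≠ 0. Then B = λ · I₅ (a scalar matrix) and λ² = μ. -/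
theorem stmt_2 (B : Matrix (Fin 5) (Fin 5) ℂ) (lam mu : ℂ)
    (J : Matrix (Fin 5) (Fin 5) ℂ)
    (hJ : J = !![0, 1/2, 0, 0, 0;
                 1/2, 0, 0, 0, 0;
                 0, 0, 1, 0, 0;
                 0, 0, 0, 1, 0;
                 0, 0, 0, 0, 1])
    (hoff : ∀ i j : Fin 5, i ≠ 0 → j ≠ 0 → i ≠ j → B i j = 0)
    (hdiag : ∀ i : Fin 5, i ≠ 0 → B i i = lam)
    (hmu : mu ≠ 0)
    (hquad : B * J * B.transpose = mu • J) :
    B = lam • (1 : Matrix (Fin 5) (Fin 5) ℂ) ∧ lam ^ 2 = mu := by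
  have entry (i j : Fin 5) :
      (B i 0 * B j 1 + B i 1 * B j 0) / 2 + B i 2 * B j 2 + B i 3 * B j 3 + B i 4 * B j 4
        = mu * J i j := by
    have h := congrFun (congrFun hquad i) j
    rw [Matrix.smul_apply, smul_eq_mul] at h
    rw [← h, hJ]
    simp [Matrix.mul_apply, Fin.sum_univ_five]
    ring
  have d1 := hdiag 1 (by decide)
  have d2 := hdiag 2 (by decide)
  have d3 := hdiag 3 (by decide)
  have d4 := hdiag 4 (by decide)
  have o12 := hoff 1 2 (by decide) (by decide) (by decide)
  have o13 := hoff 1 3 (by decide) (by decide) (by decide)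
  have o14 := hoff 1 4 (by decide) (by decide) (by decide)
  have o21 := hoff 2 1 (by decide) (by decide) (by decide)
  have o23 := hoff 2 3 (by decide) (by decide) (by decide)
  have o24 := hoff 2 4 (by decide) (by decide) (by decide)
  have o31 := hoff 3 1 (by decide) (by decide) (by decide)
  have o32 := hoff 3 2 (by decide) (by decide) (by decide)
  have o34 := hoff 3 4 (by decide) (by decide) (by decide)
  have o41 := hoff 4 1 (by decide) (by decide) (by decide)
  have o42 := hoff 4 2 (by decide) (by decide) (by decide)
  have o43 := hoff 4 3 (by decide) (by decide) (by decide)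
  have hsq : lam ^ 2 = mu := by
    have h := entry 2 2
    simp [hJ, d2, o21, o23, o24] at h
    linear_combination h
  have hlam : lam ≠ 0 := by
    rintro rfl
    exact hmu (by simpa using hsq.symm)
  have c1 : B 1 0 = 0 := by
    have h := entry 1 1
    simp [hJ, d1, o12, o13, o14] at h
    exact mul_right_cancel₀ hlam (by linear_combination h / 2)
  have c2 : B 2 0 = 0 := by simpa [hJ, d1, o12, o13, o14, o21, c1, hlam] using entry 1 2
  have c3 : B 3 0 = 0 := by simpa [hJ, d1, o12, o13, o14, o31, c1, hlam] using entry 1 3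
  have c4 : B 4 0 = 0 := by simpa [hJ, d1, o12, o13, o14, o41, c1, hlam] using entry 1 4
  have r2 : B 0 2 = 0 := by simpa [hJ, d2, o21, o23, o24, c2, hlam] using entry 0 2
  have r3 : B 0 3 = 0 := by simpa [hJ, d3, o31, o32, o34, c3, hlam] using entry 0 3
  have r4 : B 0 4 = 0 := by simpa [hJ, d4, o41, o42, o43, c4, hlam] using entry 0 4
  have r0 : B 0 0 = lam := by
    have h := entry 0 1
    simp [hJ, d1, o12, o13, o14, c1] at h
    exact mul_right_cancel₀ hlam (by linear_combination 2 * h - hsq)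
  have r1 : B 0 1 = 0 := by
    have h := entry 0 0
    simp [hJ, r0, r2, r3, r4] at h
    exact mul_left_cancel₀ hlam (by linear_combination h / 2)
  refine ⟨?_, hsq⟩
  ext i j
  fin_cases i <;> fin_cases j <;> simp [*]
end
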